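/- Fix n ≥ 1 and c ∈ [0,1) with cn ∈ ℕ. For every profile P ∈ (ℝ²)ⁿ, every minimizer o of the utilitarian social cost C^u(·, P), and every prediction ô ∈ ℝ², the Coordinatewise Median with Predictions mechanism satisfies C^u(CMP(P, ô, c), P) ≤ min{ (√(2c² + 2)/(1 + c)) · OPT^u(P) + ‖ô − o‖, (√(2c² + 2)/(1 − c)) · OPT^u(P) }. Equivalently, when OPT^u(P) > 0 and the prediction error is η = ‖ô − o‖ / OPT^u(P), CMP achieves a min{√(2c² + 2)/(1 + c) + η, √(2c² + 2)/(1 − c)} approximation of the optimal utilitarian social cost. -/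

import Mathlib

/-- Euclidean distance on the plane. -/
noncomputable def eudist (a b : ℝ × ℝ) : ℝ :=
  Real.sqrt ((a.1 - b.1) ^ 2 + (a.2 - b.2) ^ 2)

/-- Utilitarian social cost: the average distance from `y` to the points of `P`. -/
noncomputable def Cu {n : ℕ} (y : ℝ × ℝ) (P : Fin n → ℝ × ℝ) : ℝ :=
  (∑ i, eudist y (P i)) / n

/-- The lower median of a multiset of `m` reals: its `⌈m/2⌉`-th smallest element. -/
noncomputable def lowerMedian (s : Multiset ℝ) : ℝ :=
  (s.sort (· ≤ ·)).getD ((s.card + 1) / 2 - 1) 0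

/-- The Coordinatewise Median with Predictions mechanism: the coordinatewise
lower median of the reported points together with `k` copies of the
prediction (where `k = c·n` for confidence `c`). -/
noncomputable def CMP {n : ℕ} (P : Fin n → ℝ × ℝ) (oh : ℝ × ℝ) (k : ℕ) : ℝ × ℝ :=
  (lowerMedian ((↑(List.ofFn fun i => (P i).1) : Multiset ℝ) + Multiset.replicate k oh.1),
   lowerMedian ((↑(List.ofFn fun i => (P i).2) : Multiset ℝ) + Multiset.replicate k oh.2))

theorem List.Pairwise.apply_getD_iff_lt_countP {α : Type*} [Preorder α] (p : α → Bool)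
    (hp : ∀ a b, a ≤ b → p b → p a) (d : α) {l : List α} (hl : l.Pairwise (· ≤ ·)) {j : ℕ}
    (hj : j < l.length) : p (l.getD j d) ↔ j < l.countP p := by
  induction l generalizing j with
  | nil => simp at hj
  | cons x l ih =>
    rw [List.pairwise_cons] at hl
    by_cases hx : p x
    · cases j with
      | zero => simp [hx]
      | succ j =>
        have := ih hl.2 (by simpa using hj)
        simpa [hx] using this
    · have h0 : l.countP p = 0 := by
        rw [List.countP_eq_zero]
        exact fun a ha h => hx (hp _ _ (hl.1 a ha) h)
      cases j with
      | zero => simp [hx, h0]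
      | succ j =>
        have := ih hl.2 (by simpa using hj)
        simpa [hx, h0] using this

section LowerMedian

theorem lowerMedian_iff_countP (p : ℝ → Prop) [DecidablePred p]
    (hp : ∀ a b, a ≤ b → p b → p a) {s : Multiset ℝ} (hs : 0 < s.card) :
    p (lowerMedian s) ↔ s.card ≤ 2 * s.countP p := by
  have h := List.Pairwise.apply_getD_iff_lt_countP (fun a => decide (p a))
    (by simpa using hp) 0 (s.pairwise_sort (· ≤ ·))
    (j := (s.card + 1) / 2 - 1) (by rw [Multiset.length_sort]; omega)
  have hc : (s.sort (· ≤ ·)).countP (fun a => decide (p a)) = s.countP p := by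
    conv_rhs => rw [← s.sort_eq (· ≤ ·)]
    rw [Multiset.coe_countP]
  rw [hc] at h
  simp only [decide_eq_true_eq] at h
  unfold lowerMedian
  rw [h]
  omega

variable {n : ℕ}

theorem card_coe_ofFn_add_replicate (x : Fin n → ℝ) (k : ℕ) (z : ℝ) :
    ((↑(List.ofFn x) : Multiset ℝ) + Multiset.replicate k z).card = n + k := by
  simp

theorem countP_coe_ofFn_add_replicate (x : Fin n → ℝ) (k : ℕ) (z : ℝ) (p : ℝ → Prop)
    [DecidablePred p] :
    ((↑(List.ofFn x) : Multiset ℝ) + Multiset.replicate k z).countP p =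
      (Finset.univ.filter fun i => p (x i)).card + if p z then k else 0 := by
  rw [Multiset.countP_add, ← Fin.univ_val_map, Multiset.countP_map, ← Multiset.coe_replicate,
    Multiset.coe_countP, List.countP_replicate]
  simp [Finset.card_def]

/-- The lower median of the reports `x` together with `k` copies of `z`. -/
noncomputable def medianWith (x : Fin n → ℝ) (k : ℕ) (z : ℝ) : ℝ :=
  lowerMedian ((↑(List.ofFn x) : Multiset ℝ) + Multiset.replicate k z)

theorem medianWith_le_iff (hn : 1 ≤ n) (x : Fin n → ℝ) (k : ℕ) (z t : ℝ) :
    medianWith x k z ≤ t ↔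
      n + k ≤ 2 * ((Finset.univ.filter fun i => x i ≤ t).card + if z ≤ t then k else 0) := by
  have h := lowerMedian_iff_countP (· ≤ t) (fun a b hab hb => hab.trans hb)
    (s := (↑(List.ofFn x) : Multiset ℝ) + Multiset.replicate k z)
    (by rw [card_coe_ofFn_add_replicate]; omega)
  rwa [card_coe_ofFn_add_replicate, countP_coe_ofFn_add_replicate] at h

theorem medianWith_lt_iff (hn : 1 ≤ n) (x : Fin n → ℝ) (k : ℕ) (z t : ℝ) :
    medianWith x k z < t ↔
      n + k ≤ 2 * ((Finset.univ.filter fun i => x i < t).card + if z < t then k else 0) := by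
  have h := lowerMedian_iff_countP (· < t) (fun a b hab hb => hab.trans_lt hb)
    (s := (↑(List.ofFn x) : Multiset ℝ) + Multiset.replicate k z)
    (by rw [card_coe_ofFn_add_replicate]; omega)
  rwa [card_coe_ofFn_add_replicate, countP_coe_ofFn_add_replicate] at h

theorem card_le_medianWith (hn : 1 ≤ n) (x : Fin n → ℝ) (k : ℕ) (z : ℝ) :
    n + k ≤ 2 * ((Finset.univ.filter fun i => x i ≤ medianWith x k z).card +
      if z ≤ medianWith x k z then k else 0) :=
  (medianWith_le_iff hn x k z _).1 le_rfl

theorem card_medianWith_le (hn : 1 ≤ n) (x : Fin n → ℝ) (k : ℕ) (z : ℝ) :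
    n + k ≤ 2 * ((Finset.univ.filter fun i => medianWith x k z ≤ x i).card +
      if medianWith x k z ≤ z then k else 0) := by
  have h := (medianWith_lt_iff hn x k z (medianWith x k z)).not.1 (lt_irrefl _)
  have hc := Finset.card_filter_add_card_filter_not (s := (Finset.univ : Finset (Fin n)))
    (fun i => x i < medianWith x k z)
  simp only [not_lt, Finset.card_univ, Fintype.card_fin] at hc
  by_cases hz : z < medianWith x k z
  · simp only [hz, hz.not_ge, if_true, if_false] at h ⊢
    omega
  · simp only [hz, not_lt.1 hz, if_true, if_false] at h ⊢
    omega

theorem medianWith_le_add (hn : 1 ≤ n) (x : Fin n → ℝ) (k : ℕ) (z z' : ℝ) :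
    medianWith x k z ≤ medianWith x k z' + |z - z'| := by
  rw [medianWith_le_iff hn]
  refine (card_le_medianWith hn x k z').trans ?_
  have h1 : (Finset.univ.filter fun i => x i ≤ medianWith x k z').card ≤
      (Finset.univ.filter fun i => x i ≤ medianWith x k z' + |z - z'|).card :=
    Finset.card_le_card (Finset.monotone_filter_right _ fun i _ hi =>
      le_add_of_le_of_nonneg hi (abs_nonneg _))
  have h2 : z' ≤ medianWith x k z' → z ≤ medianWith x k z' + |z - z'| := fun h => by
    linarith [le_abs_self (z - z')]
  split_ifs with h3 h4
  · omega
  · exact absurd (h2 h3) h4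
  all_goals omega

theorem abs_medianWith_sub_le (hn : 1 ≤ n) (x : Fin n → ℝ) (k : ℕ) (z z' : ℝ) :
    |medianWith x k z - medianWith x k z'| ≤ |z - z'| := by
  have h1 := medianWith_le_add hn x k z z'
  have h2 := medianWith_le_add hn x k z' z
  rw [abs_sub_comm z' z] at h2
  rw [abs_le]
  constructor <;> linarith

end LowerMedian

section Pointwise

theorem le_sqrt_mul_sqrt {X L D : ℝ} (hL : 0 ≤ L) (h : X ^ 2 ≤ L * D) : X ≤ √L * √D := by
  rw [← Real.sqrt_mul hL]
  exact Real.le_sqrt_of_sq_le h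

theorem sqrt_le_of_fst_nonpos {a b u v : ℝ} (ha : 0 ≤ a) (hb : 0 ≤ b) (μ : ℝ) (hu : u ≤ 0) :
    √(u ^ 2 + v ^ 2) ≤ √(1 + μ ^ 2) * √((u - a) ^ 2 + (v - b) ^ 2) + (b - μ * a) := by
  have hr : √(u ^ 2 + v ^ 2) ^ 2 = u ^ 2 + v ^ 2 := Real.sq_sqrt (by positivity)
  have hv : v ≤ √(u ^ 2 + v ^ 2) := Real.le_sqrt_of_sq_le (by nlinarith)
  set r := √(u ^ 2 + v ^ 2)
  suffices r - b + μ * a ≤ √(1 + μ ^ 2) * √((u - a) ^ 2 + (v - b) ^ 2) by linarith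
  refine le_sqrt_mul_sqrt (by positivity) ?_
  calc (r - b + μ * a) ^ 2 ≤ (1 + μ ^ 2) * ((r - b) ^ 2 + a ^ 2) := by
        nlinarith [sq_nonneg (μ * (r - b) - a)]
    _ ≤ _ := by
        refine mul_le_mul_of_nonneg_left ?_ (by positivity)
        nlinarith [mul_nonneg hb (sub_nonneg.2 hv), mul_nonneg ha (neg_nonneg.2 hu)]

theorem sqrt_le_of_snd_nonpos {a b u v : ℝ} (ha : 0 ≤ a) (hb : 0 ≤ b) (μ : ℝ) (hv : v ≤ 0) :
    √(u ^ 2 + v ^ 2) ≤ √(1 + μ ^ 2) * √((u - a) ^ 2 + (v - b) ^ 2) + (a - μ * b) := by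
  have := sqrt_le_of_fst_nonpos hb ha μ hv (v := u)
  rwa [add_comm (v ^ 2), add_comm ((v - b) ^ 2)] at this

theorem sqrt_triangle (a b u v : ℝ) :
    √(u ^ 2 + v ^ 2) ≤ √((u - a) ^ 2 + (v - b) ^ 2) + √(a ^ 2 + b ^ 2) := by
  have := norm_add_le (⟨u - a, v - b⟩ : ℂ) ⟨a, b⟩
  simpa [Complex.norm_eq_sqrt_sq_add_sq] using this

theorem sqrt_le_mul_sqrt_add (a b u v μ : ℝ) :
    √(u ^ 2 + v ^ 2) ≤ √(1 + μ ^ 2) * √((u - a) ^ 2 + (v - b) ^ 2) + √(a ^ 2 + b ^ 2) := by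
  have h1 : 1 ≤ √(1 + μ ^ 2) := Real.one_le_sqrt.2 (by nlinarith)
  have := sqrt_triangle a b u v
  nlinarith [Real.sqrt_nonneg ((u - a) ^ 2 + (v - b) ^ 2)]

theorem sqrt_le_sub_of_nonpos_of_le {a b u v μ : ℝ} (ha : 0 ≤ a) (hab : a ≤ b)
    (hμ1 : μ ≤ 1) (hu : u ≤ 0) (hv : v ≤ 0) :
    √(u ^ 2 + v ^ 2) ≤
      √(1 + μ ^ 2) * √((u - a) ^ 2 + (v - b) ^ 2) - μ * (a + b) := by
  have hr : √(u ^ 2 + v ^ 2) ^ 2 = u ^ 2 + v ^ 2 := Real.sq_sqrt (by positivity)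
  have hle : √(u ^ 2 + v ^ 2) ≤ -u - v :=
    Real.sqrt_le_iff.2 ⟨by linarith, by nlinarith [mul_nonneg_of_nonpos_of_nonpos hu hv]⟩
  set r := √(u ^ 2 + v ^ 2)
  suffices r + a + μ * b ≤ √(1 + μ ^ 2) * √((u - a) ^ 2 + (v - b) ^ 2) by nlinarith
  refine le_sqrt_mul_sqrt (by positivity) ?_
  calc (r + a + μ * b) ^ 2 ≤ (1 + μ ^ 2) * ((r + a) ^ 2 + b ^ 2) := by
        nlinarith [sq_nonneg (μ * (r + a) - b)]
    _ ≤ _ := by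
        refine mul_le_mul_of_nonneg_left ?_ (by positivity)
        nlinarith [mul_nonneg ha (sub_nonneg.2 hle),
          mul_nonneg (sub_nonneg.2 hab) (neg_nonneg.2 hv)]

theorem sqrt_le_sub_of_nonpos {a b u v μ : ℝ} (ha : 0 ≤ a) (hb : 0 ≤ b)
    (hμ1 : μ ≤ 1) (hu : u ≤ 0) (hv : v ≤ 0) :
    √(u ^ 2 + v ^ 2) ≤
      √(1 + μ ^ 2) * √((u - a) ^ 2 + (v - b) ^ 2) - μ * (a + b) := by
  rcases le_total a b with h | h
  · exact sqrt_le_sub_of_nonpos_of_le ha h hμ1 hu hv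
  · have := sqrt_le_sub_of_nonpos_of_le hb h hμ1 hv hu
    rwa [add_comm (v ^ 2), add_comm ((v - b) ^ 2), add_comm b] at this

theorem sqrt_le_sub_mul_sqrt_of_nonpos {a b u v : ℝ} (ha : 0 ≤ a) (hb : 0 ≤ b) (μ : ℝ)
    (hu : u ≤ 0) (hv : v ≤ 0) :
    √(u ^ 2 + v ^ 2) ≤
      √(1 + μ ^ 2) * √((u - a) ^ 2 + (v - b) ^ 2) - μ * √(a ^ 2 + b ^ 2) := by
  have hr : √(u ^ 2 + v ^ 2) ^ 2 = u ^ 2 + v ^ 2 := Real.sq_sqrt (by positivity)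
  have hρ : √(a ^ 2 + b ^ 2) ^ 2 = a ^ 2 + b ^ 2 := Real.sq_sqrt (by positivity)
  set r := √(u ^ 2 + v ^ 2)
  set ρ := √(a ^ 2 + b ^ 2)
  suffices r + μ * ρ ≤ √(1 + μ ^ 2) * √((u - a) ^ 2 + (v - b) ^ 2) by linarith
  refine le_sqrt_mul_sqrt (by positivity) ?_
  calc (r + μ * ρ) ^ 2 ≤ (1 + μ ^ 2) * (r ^ 2 + ρ ^ 2) := by
        nlinarith [sq_nonneg (μ * r - ρ)]
    _ ≤ _ := by
        refine mul_le_mul_of_nonneg_left ?_ (by positivity)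
        nlinarith [mul_nonneg ha (neg_nonneg.2 hu), mul_nonneg hb (neg_nonneg.2 hv)]

/-- Dual certificate: the excess of `‖p‖` over `√(1 + μ²) ‖p - (a, b)‖` is bounded by a
nonnegative combination of centred indicators of the two coordinate half-planes. -/
theorem exists_dual_weights {a b μ q : ℝ} (ha : 0 ≤ a) (hb : 0 ≤ b) (hμ0 : 0 ≤ μ)
    (hq : q * (1 + μ) = 1) :
    ∃ A B : ℝ, 0 ≤ A ∧ 0 ≤ B ∧ (a = 0 → A = 0) ∧ (b = 0 → B = 0) ∧ ∀ u v : ℝ,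
      √(u ^ 2 + v ^ 2) ≤ √(1 + μ ^ 2) * √((u - a) ^ 2 + (v - b) ^ 2) +
        A * (q - if u ≤ 0 then 1 else 0) + B * (q - if v ≤ 0 then 1 else 0) := by
  have hρa : a ≤ √(a ^ 2 + b ^ 2) := Real.le_sqrt_of_sq_le (by nlinarith)
  have hρb : b ≤ √(a ^ 2 + b ^ 2) := Real.le_sqrt_of_sq_le (by nlinarith)
  have hρ : √(a ^ 2 + b ^ 2) ≤ a + b :=
    Real.sqrt_le_iff.2 ⟨by linarith, by nlinarith [mul_nonneg ha hb]⟩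
  rcases le_total μ 1 with hμ1 | hμ1
  · refine ⟨a * (1 + μ), b * (1 + μ), by positivity, by positivity, by simp +contextual,
      by simp +contextual, fun u v => ?_⟩
    have e (z : ℝ) : a * (1 + μ) * (q - z) = a * (1 - (1 + μ) * z) := by linear_combination a * hq
    have e' (z : ℝ) : b * (1 + μ) * (q - z) = b * (1 - (1 + μ) * z) := by linear_combination b * hq
    rw [e, e']
    split_ifs with hu hv hv
    · linarith [sqrt_le_sub_of_nonpos ha hb hμ1 hu hv]
    · linarith [sqrt_le_of_fst_nonpos ha hb μ hu (v := v)]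
    · linarith [sqrt_le_of_snd_nonpos ha hb μ hv (u := u)]
    · linarith [sqrt_le_mul_sqrt_add a b u v μ]
  · set ρ := √(a ^ 2 + b ^ 2) with hρdef
    refine ⟨ρ - b + μ * a, μ * (ρ - a) + b, ?_, ?_, ?_, ?_, fun u v => ?_⟩
    · nlinarith
    · nlinarith
    · rintro rfl
      simp [hρdef, Real.sqrt_sq hb]
    · rintro rfl
      simp [hρdef, Real.sqrt_sq ha]
    · have e (z w : ℝ) : (ρ - b + μ * a) * (q - z) + (μ * (ρ - a) + b) * (q - w) =
          ρ - (ρ - b + μ * a) * z - (μ * (ρ - a) + b) * w := by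
        linear_combination ρ * hq
      rw [add_assoc, e]
      split_ifs with hu hv hv
      · linarith [sqrt_le_sub_mul_sqrt_of_nonpos ha hb μ hu hv]
      · linarith [sqrt_le_of_fst_nonpos ha hb μ hu (v := v)]
      · nlinarith [sqrt_le_of_snd_nonpos ha hb μ hv (u := u)]
      · linarith [sqrt_le_mul_sqrt_add a b u v μ]

end Pointwise

section Cost

variable {n : ℕ}

theorem exists_orientation {x : Fin n → ℝ} {m t Q : ℝ}
    (h1 : m < t → Q ≤ ((Finset.univ.filter fun i => x i ≤ m).card : ℝ))
    (h2 : t < m → Q ≤ ((Finset.univ.filter fun i => m ≤ x i).card : ℝ)) :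
    ∃ σ : ℝ, σ ^ 2 = 1 ∧ 0 ≤ σ * (t - m) ∧
      (σ * (t - m) ≠ 0 →
        Q ≤ ((Finset.univ.filter fun i => σ * (x i - m) ≤ 0).card : ℝ)) := by
  rcases le_or_gt m t with h | h
  · refine ⟨1, by norm_num, by linarith, fun hne => ?_⟩
    have hmt : m < t := lt_of_le_of_ne h fun h' => hne (by rw [h']; ring)
    simpa using h1 hmt
  · refine ⟨-1, by norm_num, by linarith, fun _ => ?_⟩
    simpa using h2 h

theorem sum_mul_sub_indicator_nonpos {A a q : ℝ} (hA : 0 ≤ A) (h0 : a = 0 → A = 0)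
    {p : Fin n → Prop} [DecidablePred p]
    (h : a ≠ 0 → n * q ≤ ((Finset.univ.filter p).card : ℝ)) :
    ∑ i, A * (q - if p i then 1 else 0) ≤ 0 := by
  rw [← Finset.mul_sum, Finset.sum_sub_distrib, Finset.sum_boole]
  by_cases ha : a = 0
  · simp [h0 ha]
  · refine mul_nonpos_of_nonneg_of_nonpos hA ?_
    simpa using h ha

/-- If the half-plane bounded by each axis-parallel line through `f` and lying opposite to `o`
contains a fraction at least `q = 1 / (1 + μ)` of the points, then the cost of `f` is at most
`√(1 + μ²)` times the cost of `o`. -/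
theorem Cu_le_of_card (P : Fin n → ℝ × ℝ) (f o : ℝ × ℝ) {μ q : ℝ} (hμ : 0 ≤ μ)
    (hq : q * (1 + μ) = 1)
    (hx1 : f.1 < o.1 → n * q ≤ ((Finset.univ.filter fun i => (P i).1 ≤ f.1).card : ℝ))
    (hx2 : o.1 < f.1 → n * q ≤ ((Finset.univ.filter fun i => f.1 ≤ (P i).1).card : ℝ))
    (hy1 : f.2 < o.2 → n * q ≤ ((Finset.univ.filter fun i => (P i).2 ≤ f.2).card : ℝ))
    (hy2 : o.2 < f.2 → n * q ≤ ((Finset.univ.filter fun i => f.2 ≤ (P i).2).card : ℝ)) :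
    Cu f P ≤ √(1 + μ ^ 2) * Cu o P := by
  obtain ⟨σ, hσ, ha, hσc⟩ := exists_orientation hx1 hx2
  obtain ⟨τ, hτ, hb, hτc⟩ := exists_orientation hy1 hy2
  obtain ⟨A, B, hA, hB, hA0, hB0, h⟩ := exists_dual_weights ha hb hμ hq
  unfold Cu
  rw [mul_div_assoc']
  refine div_le_div_of_nonneg_right ?_ (Nat.cast_nonneg n)
  have hpt (i : Fin n) : eudist f (P i) ≤ √(1 + μ ^ 2) * eudist o (P i) +
      A * (q - if σ * ((P i).1 - f.1) ≤ 0 then 1 else 0) +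
      B * (q - if τ * ((P i).2 - f.2) ≤ 0 then 1 else 0) := by
    convert h (σ * ((P i).1 - f.1)) (τ * ((P i).2 - f.2)) using 4
    · unfold eudist
      congr 1
      linear_combination -((P i).1 - f.1) ^ 2 * hσ - ((P i).2 - f.2) ^ 2 * hτ
    · unfold eudist
      congr 1
      linear_combination -((P i).1 - o.1) ^ 2 * hσ - ((P i).2 - o.2) ^ 2 * hτ
  calc ∑ i, eudist f (P i) ≤ _ := Finset.sum_le_sum fun i _ => hpt i
    _ ≤ _ := by
      rw [Finset.sum_add_distrib, Finset.sum_add_distrib, ← Finset.mul_sum]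
      linarith [sum_mul_sub_indicator_nonpos hA hA0 hσc, sum_mul_sub_indicator_nonpos hB hB0 hτc]

theorem eudist_triangle (a b p : ℝ × ℝ) : eudist a p ≤ eudist b p + eudist a b := by
  have := sqrt_triangle (a.1 - b.1) (a.2 - b.2) (a.1 - p.1) (a.2 - p.2)
  simpa [eudist] using this

theorem Cu_le_add_eudist (hn : 1 ≤ n) (P : Fin n → ℝ × ℝ) (f g : ℝ × ℝ) :
    Cu f P ≤ Cu g P + eudist f g := by
  have hn' : (0 : ℝ) < n := by exact_mod_cast hn
  unfold Cu
  rw [div_add' _ _ _ hn'.ne']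
  refine div_le_div_of_nonneg_right ?_ hn'.le
  calc ∑ i, eudist f (P i) ≤ ∑ i, (eudist g (P i) + eudist f g) :=
        Finset.sum_le_sum fun i _ => eudist_triangle f g (P i)
    _ = _ := by simp [Finset.sum_add_distrib, mul_comm]

theorem eudist_CMP_le (hn : 1 ≤ n) (P : Fin n → ℝ × ℝ) (z z' : ℝ × ℝ) (k : ℕ) :
    eudist (CMP P z k) (CMP P z' k) ≤ eudist z z' :=
  Real.sqrt_le_sqrt (add_le_add
    (sq_le_sq.2 (abs_medianWith_sub_le hn (fun i => (P i).1) k z.1 z'.1))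
    (sq_le_sq.2 (abs_medianWith_sub_le hn (fun i => (P i).2) k z.2 z'.2)))

theorem sqrt_one_add_div_sq (s : ℝ) {t : ℝ} (ht : 0 < t) :
    √(1 + (s / t) ^ 2) = √(t ^ 2 + s ^ 2) / t := by
  rw [show 1 + (s / t) ^ 2 = (t ^ 2 + s ^ 2) / t ^ 2 by field_simp,
    Real.sqrt_div (by positivity), Real.sqrt_sq ht.le]

theorem le_card_of_lt_medianWith (hn : 1 ≤ n) (x : Fin n → ℝ) {k : ℕ} {c : ℝ}
    (hk : (k : ℝ) = c * n) {z : ℝ} (h : medianWith x k z < z) :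
    n * ((1 + c) / 2) ≤ ((Finset.univ.filter fun i => x i ≤ medianWith x k z).card : ℝ) := by
  have := card_le_medianWith hn x k z
  rw [if_neg h.not_ge, add_zero] at this
  rify at this
  linarith

theorem le_card_of_medianWith_lt (hn : 1 ≤ n) (x : Fin n → ℝ) {k : ℕ} {c : ℝ}
    (hk : (k : ℝ) = c * n) {z : ℝ} (h : z < medianWith x k z) :
    n * ((1 + c) / 2) ≤ ((Finset.univ.filter fun i => medianWith x k z ≤ x i).card : ℝ) := by
  have := card_medianWith_le hn x k z
  rw [if_neg h.not_ge, add_zero] at this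
  rify at this
  linarith

theorem le_card_le_medianWith (hn : 1 ≤ n) (x : Fin n → ℝ) {k : ℕ} {c : ℝ}
    (hk : (k : ℝ) = c * n) (z : ℝ) :
    n * ((1 - c) / 2) ≤ ((Finset.univ.filter fun i => x i ≤ medianWith x k z).card : ℝ) := by
  have h := card_le_medianWith hn x k z
  have : n ≤ 2 * (Finset.univ.filter fun i => x i ≤ medianWith x k z).card + k := by
    split_ifs at h <;> omega
  have : (n : ℝ) ≤ 2 * ((Finset.univ.filter fun i => x i ≤ medianWith x k z).card : ℝ) + k := by
    exact_mod_cast this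
  linarith

theorem le_card_medianWith_le (hn : 1 ≤ n) (x : Fin n → ℝ) {k : ℕ} {c : ℝ}
    (hk : (k : ℝ) = c * n) (z : ℝ) :
    n * ((1 - c) / 2) ≤ ((Finset.univ.filter fun i => medianWith x k z ≤ x i).card : ℝ) := by
  have h := card_medianWith_le hn x k z
  have : n ≤ 2 * (Finset.univ.filter fun i => medianWith x k z ≤ x i).card + k := by
    split_ifs at h <;> omega
  have : (n : ℝ) ≤ 2 * ((Finset.univ.filter fun i => medianWith x k z ≤ x i).card : ℝ) + k := by
    exact_mod_cast this
  linarith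

/-- Consistency: with a perfect prediction the cost ratio is at most `√(2c² + 2) / (1 + c)`. -/
theorem Cu_CMP_self_le (hn : 1 ≤ n) {c : ℝ} (hc0 : 0 ≤ c) (hc1 : c < 1) {k : ℕ}
    (hk : (k : ℝ) = c * n) (P : Fin n → ℝ × ℝ) (o : ℝ × ℝ) :
    Cu (CMP P o k) P ≤ √(2 * c ^ 2 + 2) / (1 + c) * Cu o P := by
  have hpos : 0 < 1 + c := by linarith
  have h := Cu_le_of_card P (CMP P o k) o (μ := (1 - c) / (1 + c)) (q := (1 + c) / 2)
    (div_nonneg (by linarith) hpos.le) (by field_simp; ring)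
    (le_card_of_lt_medianWith hn (fun i => (P i).1) hk)
    (le_card_of_medianWith_lt hn (fun i => (P i).1) hk)
    (le_card_of_lt_medianWith hn (fun i => (P i).2) hk)
    (le_card_of_medianWith_lt hn (fun i => (P i).2) hk)
  rw [sqrt_one_add_div_sq _ hpos] at h
  convert h using 4
  ring

/-- Robustness: for an arbitrary prediction the cost ratio is at most `√(2c² + 2) / (1 - c)`. -/
theorem Cu_CMP_le (hn : 1 ≤ n) {c : ℝ} (hc0 : 0 ≤ c) (hc1 : c < 1) {k : ℕ}
    (hk : (k : ℝ) = c * n) (P : Fin n → ℝ × ℝ) (o z : ℝ × ℝ) :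
    Cu (CMP P z k) P ≤ √(2 * c ^ 2 + 2) / (1 - c) * Cu o P := by
  have hpos : 0 < 1 - c := by linarith
  have h := Cu_le_of_card P (CMP P z k) o (μ := (1 + c) / (1 - c)) (q := (1 - c) / 2)
    (div_nonneg (by linarith) hpos.le) (by field_simp; ring)
    (fun _ => le_card_le_medianWith hn (fun i => (P i).1) hk z.1)
    (fun _ => le_card_medianWith_le hn (fun i => (P i).1) hk z.1)
    (fun _ => le_card_le_medianWith hn (fun i => (P i).2) hk z.2)
    (fun _ => le_card_medianWith_le hn (fun i => (P i).2) hk z.2)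
  rw [sqrt_one_add_div_sq _ hpos] at h
  convert h using 4
  ring

end Cost

/-- refined guarantee of CMP as a function of the prediction
error: its utilitarian cost is at most
min((√(2c²+2)/(1+c))·OPT + dist(prediction, optimum), (√(2c²+2)/(1−c))·OPT). -/
theorem CMP_error_bound (n : ℕ) (hn : 1 ≤ n) (c : ℝ) (hc0 : 0 ≤ c) (hc1 : c < 1)
    (k : ℕ) (hk : (k : ℝ) = c * n)
    (P : Fin n → ℝ × ℝ) (o : ℝ × ℝ) (ho : ∀ y : ℝ × ℝ, Cu o P ≤ Cu y P) (oh : ℝ × ℝ) :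
    Cu (CMP P oh k) P ≤
      min ((Real.sqrt (2 * c ^ 2 + 2) / (1 + c)) * Cu o P + eudist oh o)
          ((Real.sqrt (2 * c ^ 2 + 2) / (1 - c)) * Cu o P) := by
  refine le_min ?_ (Cu_CMP_le hn hc0 hc1 hk P o oh)
  calc Cu (CMP P oh k) P ≤ Cu (CMP P o k) P + eudist (CMP P oh k) (CMP P o k) :=
        Cu_le_add_eudist hn P _ _
    _ ≤ _ := add_le_add (Cu_CMP_self_le hn hc0 hc1 hk P o) (eudist_CMP_le hn P oh o k)
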